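/- For every prime power q: A^-(1)(q) = q+1; A^-(n)(q) = A(n)(q) for every odd n > 1; A^-(n)(q) = 0 for every even n > 0; A^+(1)(q) = q(q−1)/2 − 1; and A^+(n)(q) = A(2n)(q) for every n > 1. -/

import Mathlib

open Polynomial

/-- The dual polynomial: if `p = a₀ ∏ (X − αᵢ)` over its splitting field, the dual is
`a₀ ∏ (X − αᵢ^{−q})`, regarded as a polynomial over the splitting field. -/
noncomputable def dualPoly {F : Type*} [Field F] (q : ℕ) (p : Polynomial F) :
    Polynomial p.SplittingField :=
  Polynomial.C (algebraMap F p.SplittingField p.leadingCoeff) *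
    ((p.aroots p.SplittingField).map fun α => Polynomial.X - Polynomial.C (α⁻¹ ^ q)).prod

/-- A polynomial is self-dual if it coincides with its dual polynomial. -/
def IsSelfDual {F : Type*} [Field F] (q : ℕ) (p : Polynomial F) : Prop :=
  p.map (algebraMap F p.SplittingField) = dualPoly q p

/-- `A(d)` over a field `E`: the number of irreducible monic polynomials of degree `d`
over `E` with nonzero constant term. -/
noncomputable def Acount (E : Type*) [Field E] (d : ℕ) : ℕ :=
  Nat.card {p : Polynomial E // p.Monic ∧ p.natDegree = d ∧ p.coeff 0 ≠ 0 ∧ Irreducible p}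

/-- `A⁻(d)(q)`: the number of self-dual irreducible monic polynomials of degree `d`
over `F_{q²}` with nonzero constant term. -/
noncomputable def Aminus (q : ℕ) (F : Type*) [Field F] (d : ℕ) : ℕ :=
  Nat.card {p : Polynomial F //
    p.Monic ∧ p.natDegree = d ∧ p.coeff 0 ≠ 0 ∧ Irreducible p ∧ IsSelfDual q p}

/-- `A⁺(d)(q) = (A(d)(q²) − A⁻(d)(q))/2`. -/
noncomputable def Aplus (q : ℕ) (F : Type*) [Field F] (d : ℕ) : ℚ :=
  ((Acount F d : ℚ) - (Aminus q F d : ℚ)) / 2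

open Function

section FrobeniusOrbits

variable {k Ω : Type*} [Field k] [Finite k] [Field Ω] [Algebra k Ω]

theorem natDegree_minpoly_dvd_iff_isPeriodicPt {x : Ω} (hx : IsIntegral k x) (m : ℕ) :
    (minpoly k x).natDegree ∣ m ↔ IsPeriodicPt (fun y : Ω => y ^ Nat.card k) m x := by
  rw [(minpoly.irreducible hx).natDegree_dvd_iff_dvd_X_pow_card_pow_sub_X, minpoly.dvd_iff,
    IsPeriodicPt, IsFixedPt, pow_iterate]
  simp [sub_eq_zero]

theorem natDegree_minpoly_eq_minimalPeriod {x : Ω} (hx : IsIntegral k x) :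
    (minpoly k x).natDegree = minimalPeriod (fun y : Ω => y ^ Nat.card k) x := by
  refine Nat.dvd_right_iff_eq.1 fun m => ?_
  rw [natDegree_minpoly_dvd_iff_isPeriodicPt hx, isPeriodicPt_iff_minimalPeriod_dvd]

theorem finite_setOf_iterate_pow_eq {Q n : ℕ} (hQ : 1 < Q) (hn : n ≠ 0) :
    {x : Ω | (fun y : Ω => y ^ Q)^[n] x = x}.Finite := by
  have h0 : (X ^ Q ^ n - X : Polynomial Ω) ≠ 0 := FiniteField.X_pow_card_pow_sub_X_ne_zero _ hn hQ
  refine (Polynomial.finite_setOfPred_isRoot h0).subset fun x hx => ?_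
  rw [Set.mem_ofPred_eq, pow_iterate] at hx
  simpa [sub_eq_zero] using hx

theorem isIntegral_of_minimalPeriod_pos {x : Ω}
    (hx : 0 < minimalPeriod (fun y : Ω => y ^ Nat.card k) x) : IsIntegral k x := by
  have h := iterate_minimalPeriod (f := fun y : Ω => y ^ Nat.card k) (x := x)
  rw [pow_iterate] at h
  refine IsAlgebraic.isIntegral ⟨X ^ Nat.card k ^ _ - X,
    FiniteField.X_pow_card_pow_sub_X_ne_zero _ hx.ne' Finite.one_lt_card, ?_⟩
  simpa [sub_eq_zero] using h

theorem mul_card_irreducible_eq_ncard [IsAlgClosed Ω] (P : k[X] → Prop) {n : ℕ} (hn : 0 < n) :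
    n * Nat.card {p : k[X] // p.Monic ∧ p.natDegree = n ∧ p.coeff 0 ≠ 0 ∧ Irreducible p ∧ P p} =
      {x : Ω | x ≠ 0 ∧ minimalPeriod (fun y : Ω => y ^ Nat.card k) x = n ∧
        P (minpoly k x)}.ncard := by
  set S := {x : Ω | x ≠ 0 ∧ minimalPeriod (fun y : Ω => y ^ Nat.card k) x = n ∧
        P (minpoly k x)}
  have hfin : S.Finite := (finite_setOf_iterate_pow_eq (Finite.one_lt_card (α := k)) hn.ne').subset
    fun x hx => by
      have := iterate_minimalPeriod (f := fun y : Ω => y ^ Nat.card k) (x := x)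
      rwa [hx.2.1] at this
  have hint : ∀ x ∈ S, IsIntegral k x := fun x hx =>
    isIntegral_of_minimalPeriod_pos (hx.2.1 ▸ hn)
  set B := {p : k[X] // p.Monic ∧ p.natDegree = n ∧ p.coeff 0 ≠ 0 ∧ Irreducible p ∧ P p}
  let f : S → B := fun x => ⟨minpoly k x.1, minpoly.monic (hint _ x.2),
    (natDegree_minpoly_eq_minimalPeriod (hint _ x.2)).trans x.2.2.1,
    minpoly.coeff_zero_ne_zero (hint _ x.2) x.2.1, minpoly.irreducible (hint _ x.2), x.2.2.2⟩
  have hmin : ∀ b : B, ∀ x : Ω, aeval x b.1 = 0 → minpoly k x = b.1 := fun b x hx =>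
    (minpoly.eq_of_irreducible_of_monic b.2.2.2.2.1 hx b.2.1).symm
  have hmem : ∀ b : B, ∀ x : Ω, aeval x b.1 = 0 → x ∈ S := fun b x hx => by
    have hxi : IsIntegral k x := ⟨b.1, b.2.1, hx⟩
    have hb := hmin b x hx
    refine ⟨?_, ?_, hb ▸ b.2.2.2.2.2⟩
    · rintro rfl
      exact b.2.2.2.1 (by rwa [← coeff_zero_eq_aeval_zero', map_eq_zero] at hx)
    · rw [← natDegree_minpoly_eq_minimalPeriod hxi, hb, b.2.2.1]
  have : Finite S := hfin
  have hsurj : Surjective f := fun b => by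
    obtain ⟨x, hx⟩ := IsAlgClosed.exists_aeval_eq_zero Ω b.1
      (b.2.2.2.2.1.degree_pos).ne'
    exact ⟨⟨x, hmem b x hx⟩, Subtype.ext (hmin b x hx)⟩
  have : Finite B := Finite.of_surjective f hsurj
  have := Fintype.ofFinite B
  have hfib : ∀ b : B, Nat.card {x : S // f x = b} = n := fun b => by
    have e : {x : S // f x = b} ≃ b.1.rootSet Ω :=
      { toFun := fun x => ⟨x.1.1, by
          have h : minpoly k x.1.1 = b.1 := congrArg Subtype.val x.2
          rw [mem_rootSet, ← h]
          exact ⟨minpoly.ne_zero (hint _ x.1.2), minpoly.aeval _ _⟩⟩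
        invFun := fun x => ⟨⟨x.1, hmem b x.1 (mem_rootSet.1 x.2).2⟩,
          Subtype.ext (hmin b x.1 (mem_rootSet.1 x.2).2)⟩
        left_inv := fun _ => rfl
        right_inv := fun _ => rfl }
    rw [Nat.card_congr e, Nat.card_eq_fintype_card,
      card_rootSet_eq_natDegree (PerfectField.separable_of_irreducible b.2.2.2.2.1)
        (IsAlgClosed.splits _), b.2.2.1]
  rw [← Nat.card_coe_set_eq, ← Nat.card_congr (Equiv.sigmaFiberEquiv f), Nat.card_sigma]
  simp [hfib, mul_comm]

theorem mul_Acount_eq_ncard [IsAlgClosed Ω] {n : ℕ} (hn : 0 < n) :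
    n * Acount k n =
      {x : Ω | x ≠ 0 ∧ minimalPeriod (fun y : Ω => y ^ Nat.card k) x = n}.ncard := by
  simpa [Acount] using mul_card_irreducible_eq_ncard (k := k) (Ω := Ω) (fun _ => True) hn

theorem aeval_minpoly_eq_zero_iff_exists_iterate {x y : Ω} (hx : IsIntegral k x) :
    aeval y (minpoly k x) = 0 ↔ ∃ j, (fun z : Ω => z ^ Nat.card k)^[j] x = y := by
  classical
  set d := (minpoly k x).natDegree
  have hd : d = minimalPeriod (fun y : Ω => y ^ Nat.card k) x :=
    natDegree_minpoly_eq_minimalPeriod hx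
  have h0 := minpoly.ne_zero hx
  have hfrob : ∀ j, aeval ((fun z : Ω => z ^ Nat.card k)^[j] x) (minpoly k x) = 0 := by
    intro j
    let _ := Fintype.ofFinite k
    induction j with
    | zero => exact minpoly.aeval k x
    | succ j ih =>
      rw [iterate_succ_apply', Nat.card_eq_fintype_card]
      rw [Nat.card_eq_fintype_card] at ih
      have := aeval_algHom_apply (FiniteField.frobeniusAlgHom k Ω)
        ((fun z : Ω => z ^ Fintype.card k)^[j] x) (minpoly k x)
      rwa [ih, map_zero] at this
  constructor
  · intro hy
    let O := (Finset.range d).image fun j => (fun z : Ω => z ^ Nat.card k)^[j] x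
    have hO : O ⊆ ((minpoly k x).aroots Ω).toFinset := by
      intro z hz
      obtain ⟨j, -, rfl⟩ := Finset.mem_image.1 hz
      simpa [h0] using hfrob j
    have hcard : O.card = d := by
      rw [Finset.card_image_of_injOn, Finset.card_range]
      rw [hd]
      intro a ha b hb
      exact iterate_injOn_Iio_minimalPeriod (by simpa using ha) (by simpa using hb)
    have := Finset.eq_of_subset_of_card_le hO (by
      rw [hcard]
      refine (Multiset.toFinset_card_le _).trans ((card_roots' _).trans ?_)
      rw [natDegree_map])
    have hyO : y ∈ O := by rw [this]; simpa [h0] using hy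
    obtain ⟨j, -, hj⟩ := Finset.mem_image.1 hyO
    exact ⟨j, hj⟩
  · rintro ⟨j, rfl⟩
    exact hfrob j

end FrobeniusOrbits

section Periods

variable {α : Type*} {f : α → α} {x : α}

theorem minimalPeriod_iterate_two_of_odd {m : ℕ} (h : minimalPeriod f x = m) (hm : Odd m) :
    minimalPeriod f^[2] x = m := by
  rw [minimalPeriod_iterate_eq_div_gcd two_ne_zero, h,
    Nat.Coprime.gcd_eq_one (Nat.coprime_two_right.2 hm), Nat.div_one]

theorem minimalPeriod_iterate_two_eq_iff {n : ℕ} (hn : 0 < n) :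
    minimalPeriod f^[2] x = n ↔
      minimalPeriod f x = 2 * n ∨ Odd n ∧ minimalPeriod f x = n := by
  rcases Nat.even_or_odd (minimalPeriod f x) with h | h
  · rw [minimalPeriod_iterate_eq_div_gcd two_ne_zero, Nat.gcd_eq_right h.two_dvd]
    obtain ⟨r, hr⟩ := h
    rw [hr]
    constructor
    · intro; left; omega
    · rintro (h | ⟨⟨s, hs⟩, h⟩) <;> omega
  · rw [minimalPeriod_iterate_two_of_odd rfl h]
    constructor
    · rintro rfl; exact .inr ⟨h, rfl⟩
    · rintro (h' | ⟨-, h'⟩)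
      · obtain ⟨r, hr⟩ := h; omega
      · exact h'

theorem exists_iterate_two_eq_apply_iff (hf : Injective f) :
    (∃ j, (f^[2])^[j] x = f x) ↔ Odd (minimalPeriod f x) := by
  constructor
  · rintro ⟨j, hj⟩
    rw [← iterate_mul] at hj
    rcases j with _ | j
    · have : minimalPeriod f x = 1 := minimalPeriod_eq_one_iff_isFixedPt.2 hj.symm
      simp [this]
    · have h : IsPeriodicPt f (2 * j + 1) x := by
        apply hf
        rw [← hj, ← iterate_succ_apply' f]
        rfl
      exact Odd.of_dvd_nat (by simp) h.minimalPeriod_dvd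
  · rintro ⟨r, hr⟩
    refine ⟨r + 1, ?_⟩
    rw [← iterate_mul, show 2 * (r + 1) = (minimalPeriod f x).succ by omega, iterate_succ_apply',
      iterate_minimalPeriod]

theorem sum_ncard_minimalPeriod_eq {n : ℕ} (hn : n ≠ 0) (P : α → Prop)
    (hfin : {x | P x ∧ f^[n] x = x}.Finite) :
    ∑ d ∈ n.divisors, {x | P x ∧ minimalPeriod f x = d}.ncard =
      {x | P x ∧ f^[n] x = x}.ncard := by
  classical
  rw [Set.ncard_eq_toFinset_card _ hfin,
    Finset.card_eq_sum_card_fiberwise (f := minimalPeriod f) (t := n.divisors)]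
  · refine Finset.sum_congr rfl fun d hd => ?_
    rw [← Set.ncard_coe_finset]
    congr 1
    ext x
    simp only [Set.mem_ofPred_eq, Finset.coe_filter, Set.Finite.mem_toFinset]
    constructor
    · rintro ⟨hP, rfl⟩
      exact ⟨⟨hP, isPeriodicPt_iff_minimalPeriod_dvd.2 (Nat.dvd_of_mem_divisors hd)⟩, rfl⟩
    · rintro ⟨⟨hP, -⟩, h⟩
      exact ⟨hP, h⟩
  · intro _ hx
    replace hx := hfin.mem_toFinset.1 hx
    simpa [hn] using (IsPeriodicPt.minimalPeriod_dvd (n := n) hx.2)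

end Periods

section DualMap

variable {Ω : Type*} [Field Ω]

theorem inv_pow_iterate_two (q : ℕ) :
    (fun y : Ω => y⁻¹ ^ q)^[2] = fun y : Ω => y ^ q ^ 2 := by
  ext x
  simp [← pow_mul, sq]

theorem inv_pow_iterate_of_odd (q : ℕ) {n : ℕ} (hn : Odd n) (x : Ω) :
    (fun y : Ω => y⁻¹ ^ q)^[n] x = x⁻¹ ^ q ^ n := by
  obtain ⟨r, rfl⟩ := hn
  refine (iterate_succ_apply' _ (2 * r) x).trans ?_
  rw [iterate_mul, inv_pow_iterate_two, pow_iterate, ← inv_pow, ← pow_mul,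
    ← pow_mul, pow_succ]

variable [IsAlgClosed Ω]

theorem ncard_pow_eq_one {N : ℕ} (hN : (N : Ω) ≠ 0) : {x : Ω | x ^ N = 1}.ncard = N := by
  have : NeZero (N : Ω) := ⟨hN⟩
  have hN0 : 0 < N := Nat.pos_of_ne_zero fun h => hN (by simp [h])
  obtain ⟨ζ, hζ⟩ := HasEnoughRootsOfUnity.exists_primitiveRoot Ω N
  trans (nthRootsFinset N (1 : Ω)).card
  · rw [← Set.ncard_coe_finset]
    congr 1
    ext x
    simp [mem_nthRootsFinset hN0]
  · exact hζ.card_nthRootsFinset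

theorem ncard_iterate_pow_eq {q n : ℕ} (hq : (q : Ω) = 0) (hq0 : 0 < q) (hn : n ≠ 0) :
    {x : Ω | x ≠ 0 ∧ (fun y : Ω => y ^ q)^[n] x = x}.ncard = q ^ n - 1 := by
  have hpos : 0 < q ^ n := pow_pos hq0 n
  have hN : ((q ^ n - 1 : ℕ) : Ω) ≠ 0 := by
    rw [Nat.cast_sub hpos]
    simp [hq, hn]
  rw [← ncard_pow_eq_one hN]
  congr 1
  ext x
  simp only [Set.mem_ofPred_eq, pow_iterate]
  constructor
  · rintro ⟨hx, h⟩
    refine mul_right_cancel₀ hx ?_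
    rw [← pow_succ, Nat.sub_add_cancel hpos, h, one_mul]
  · intro h
    refine ⟨?_, ?_⟩
    · rintro rfl
      rw [zero_pow (fun h0 => hN (by rw [h0, Nat.cast_zero]))] at h
      exact zero_ne_one h
    · rw [← Nat.sub_add_cancel hpos, pow_succ, h, one_mul]

theorem ncard_iterate_inv_pow_eq {q n : ℕ} (hq : (q : Ω) = 0) (hn : Odd n) :
    {x : Ω | x ≠ 0 ∧ (fun y : Ω => y⁻¹ ^ q)^[n] x = x}.ncard = q ^ n + 1 := by
  have hN : ((q ^ n + 1 : ℕ) : Ω) ≠ 0 := by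
    simp [hq, hn.pos.ne']
  rw [← ncard_pow_eq_one hN]
  congr 1
  ext x
  simp only [Set.mem_ofPred_eq, inv_pow_iterate_of_odd q hn]
  constructor
  · rintro ⟨hx, h⟩
    rw [pow_succ]
    nth_rewrite 2 [← h]
    rw [inv_pow, mul_inv_cancel₀ (pow_ne_zero _ hx)]
  · intro h
    have hx : x ≠ 0 := by
      rintro rfl
      simp at h
    refine ⟨hx, ?_⟩
    rw [inv_pow]
    exact inv_eq_of_mul_eq_one_right (by rw [← pow_succ, h])

/-- For odd `n`, the maps `y ↦ y⁻¹ ^ q` and `y ↦ y ^ q` have equally many nonzero points of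
minimal period `n`, except that the former has two more fixed points. -/
theorem ncard_minimalPeriod_inv_pow {q : ℕ} (hq : (q : Ω) = 0) (hq1 : 1 < q) {n : ℕ}
    (hn : Odd n) :
    {x : Ω | x ≠ 0 ∧ minimalPeriod (fun y : Ω => y⁻¹ ^ q) x = n}.ncard =
      {x : Ω | x ≠ 0 ∧ minimalPeriod (fun y : Ω => y ^ q) x = n}.ncard +
        if n = 1 then 2 else 0 := by
  induction n using Nat.strong_induction_on with
  | _ n ih =>
    have hfin₁ : {x : Ω | x ≠ 0 ∧ (fun y : Ω => y⁻¹ ^ q)^[n] x = x}.Finite :=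
      Set.finite_of_ncard_ne_zero (by rw [ncard_iterate_inv_pow_eq hq hn]; simp)
    have hfin₂ : {x : Ω | x ≠ 0 ∧ (fun y : Ω => y ^ q)^[n] x = x}.Finite :=
      (finite_setOf_iterate_pow_eq hq1 hn.pos.ne').subset fun x hx => hx.2
    have h₁ := sum_ncard_minimalPeriod_eq hn.pos.ne' _ hfin₁
    have h₂ := sum_ncard_minimalPeriod_eq hn.pos.ne' _ hfin₂
    rw [ncard_iterate_inv_pow_eq hq hn, ← Nat.cons_self_properDivisors hn.pos.ne',
      Finset.sum_cons] at h₁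
    rw [ncard_iterate_pow_eq hq (by omega) hn.pos.ne',
      ← Nat.cons_self_properDivisors hn.pos.ne', Finset.sum_cons] at h₂
    have hpos : 0 < q ^ n := pow_pos (by omega) n
    have hsum := Finset.sum_congr (rfl : n.properDivisors = n.properDivisors) fun d hd =>
      ih d (Nat.mem_properDivisors.1 hd).2 (hn.of_dvd_nat (Nat.mem_properDivisors.1 hd).1)
    rw [Finset.sum_add_distrib, Finset.sum_ite_eq' n.properDivisors 1] at hsum
    have hone : 1 ∈ n.properDivisors ↔ n ≠ 1 := by
      have := hn.pos
      simp [Nat.mem_properDivisors]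
      omega
    by_cases h : n = 1
    · subst h
      rw [Nat.properDivisors_one, Finset.sum_empty] at h₁ h₂
      rw [if_pos rfl]
      omega
    · rw [if_pos (hone.2 h)] at hsum
      rw [if_neg h]
      omega

end DualMap

section SelfDual

variable {F : Type*} [Field F]

theorem inv_pow_injective [Finite F] {q : ℕ} (hF : Nat.card F = q ^ 2) (L : Type*) [Field L]
    [Algebra F L] : Injective (fun y : L => y⁻¹ ^ q) := by
  have h : Injective (fun y : L => y⁻¹ ^ q)^[2] := by
    let _ := Fintype.ofFinite F
    rw [inv_pow_iterate_two, ← hF, Nat.card_eq_fintype_card]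
    exact (FiniteField.frobeniusAlgHom F L).injective
  exact Injective.of_comp h

theorem isSelfDual_iff_forall_root {q : ℕ} {p : F[X]} (hp : p.Separable)
    (hinj : Injective (fun y : p.SplittingField => y⁻¹ ^ q)) :
    IsSelfDual q p ↔ ∀ α : p.SplittingField, aeval α p = 0 → aeval (α⁻¹ ^ q) p = 0 := by
  have hs : (p.map (algebraMap F p.SplittingField)).Splits := SplittingField.splits p
  have h0 : p.map (algebraMap F p.SplittingField) ≠ 0 := hp.map.ne_zero
  have hroots : ∀ α : p.SplittingField, aeval α p = 0 ↔ α ∈ p.aroots p.SplittingField := by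
    intro α
    rw [mem_aroots, and_iff_right hp.ne_zero]
  constructor
  · intro h α hα
    rw [← eval_map_algebraMap, h, dualPoly, eval_mul, eval_multiset_prod, mul_eq_zero]
    right
    rw [Multiset.map_map]
    exact Multiset.prod_eq_zero (Multiset.mem_map.2 ⟨α, (hroots α).1 hα, by simp⟩)
  · intro h
    have hperm : (p.aroots p.SplittingField).map (fun α => α⁻¹ ^ q) =
        p.aroots p.SplittingField := by
      refine Multiset.eq_of_le_of_card_le ?_ (by rw [Multiset.card_map])
      rw [Multiset.le_iff_subset ((nodup_roots hp.map).map hinj)]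
      intro β hβ
      obtain ⟨α, hα, rfl⟩ := Multiset.mem_map.1 hβ
      exact (hroots _).1 (h α ((hroots α).2 hα))
    rw [IsSelfDual, dualPoly]
    conv_lhs => rw [hs.eq_prod_roots, leadingCoeff_map, ← aroots, ← hperm, Multiset.map_map]
    rfl

theorem isSelfDual_minpoly_iff [Finite F] {q : ℕ} (hF : Nat.card F = q ^ 2)
    {Ω : Type*} [Field Ω] [Algebra F Ω] [Normal F Ω] (x : Ω) :
    IsSelfDual q (minpoly F x) ↔ aeval (x⁻¹ ^ q) (minpoly F x) = 0 := by
  have hx : IsIntegral F x := Normal.isIntegral inferInstance x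
  have hirr := minpoly.irreducible hx
  have hsplit : ((minpoly F x).map (algebraMap F Ω)).Splits := Normal.splits inferInstance x
  rw [isSelfDual_iff_forall_root (PerfectField.separable_of_irreducible hirr)
    (inv_pow_injective hF _)]
  let i : (minpoly F x).SplittingField →ₐ[F] Ω := SplittingField.lift _ hsplit
  have hi : ∀ α, aeval (i α) (minpoly F x) = 0 ↔ aeval α (minpoly F x) = 0 := fun α => by
    rw [aeval_algHom_apply, map_eq_zero]
  have himage : x ∈ i '' (minpoly F x).rootSet (minpoly F x).SplittingField := by
    rw [(SplittingField.splits (minpoly F x)).image_rootSet, mem_rootSet]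
    exact ⟨hirr.ne_zero, minpoly.aeval F x⟩
  obtain ⟨a, ha, hax⟩ := himage
  constructor
  · intro h
    rw [← hax, ← map_inv₀, ← map_pow]
    rw [hax]
    exact (hi _).2 (h a (mem_rootSet.1 ha).2)
  · intro h α hα
    have hconj : IsConjRoot F (i α) x :=
      (minpoly.eq_of_irreducible_of_monic hirr ((hi α).2 hα) (minpoly.monic hx)).symm
    obtain ⟨σ, hσ⟩ := hconj.exists_algEquiv
    rw [← hi, map_pow, map_inv₀, ← hσ, ← map_inv₀, ← map_pow, aeval_algHom_apply, h, map_zero]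

theorem mul_Aminus_eq [Finite F] {q : ℕ} (hF : Nat.card F = q ^ 2) {Ω : Type*} [Field Ω]
    [Algebra F Ω] [IsAlgClosed Ω] [Normal F Ω] {n : ℕ} (hn : 0 < n) :
    n * Aminus q F n = if Odd n then
      {x : Ω | x ≠ 0 ∧ minimalPeriod (fun y : Ω => y⁻¹ ^ q) x = n}.ncard else 0 := by
  have hsd : ∀ x : Ω, IsSelfDual q (minpoly F x) ↔
      Odd (minimalPeriod (fun y : Ω => y⁻¹ ^ q) x) := by
    intro x
    have hx : IsIntegral F x := Normal.isIntegral inferInstance x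
    rw [isSelfDual_minpoly_iff hF, aeval_minpoly_eq_zero_iff_exists_iterate hx,
      ← exists_iterate_two_eq_apply_iff (inv_pow_injective hF Ω), inv_pow_iterate_two, hF]
  rw [Aminus, mul_card_irreducible_eq_ncard (Ω := Ω) (IsSelfDual q) hn, hF]
  simp only [hsd, ← inv_pow_iterate_two]
  split_ifs with hodd
  · congr 1
    ext x
    simp only [Set.mem_ofPred_eq]
    refine and_congr_right fun _ => ⟨fun ⟨h, h'⟩ => ?_, fun h => ?_⟩
    · rwa [minimalPeriod_iterate_two_of_odd rfl h'] at h
    · exact ⟨minimalPeriod_iterate_two_of_odd h hodd, h ▸ hodd⟩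
  · convert Set.ncard_empty Ω
    refine Set.eq_empty_of_forall_notMem fun x ⟨_, h, h'⟩ => hodd ?_
    rw [minimalPeriod_iterate_two_of_odd rfl h'] at h
    exact h ▸ h'

end SelfDual

theorem exists_ringHom_of_card_eq {E F Ω : Type*} [Field E] [Fintype E] [Field F] [Fintype F]
    [Field Ω] [Algebra F Ω] [IsAlgClosed Ω] (h : Fintype.card F = Fintype.card E ^ 2) :
    Nonempty (E →+* Ω) := by
  obtain ⟨p, hp⟩ := CharP.exists E
  obtain ⟨m, hprime, hm⟩ := FiniteField.card E p
  have : Fact p.Prime := ⟨hprime⟩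
  have hpF : (p : F) = 0 := by
    have := FiniteField.cast_card_eq_zero F
    rw [h, hm] at this
    simpa using this
  have hpΩ : (p : Ω) = 0 := by
    rw [← map_natCast (algebraMap F Ω), hpF, map_zero]
  have : CharP Ω p := (CharP.charP_iff_prime_eq_zero hprime).2 hpΩ
  let _ := ZMod.algebra E p
  let _ := ZMod.algebra Ω p
  exact ⟨(IsAlgClosed.lift : E →ₐ[ZMod p] Ω).toRingHom⟩

theorem mul_Acount_sq_eq {E F Ω : Type*} [Field E] [Finite E] [Field F] [Finite F]
    (hF : Nat.card F = Nat.card E ^ 2) [Field Ω] [Algebra E Ω] [Algebra F Ω] [IsAlgClosed Ω]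
    {n : ℕ} (hn : 0 < n) :
    n * Acount F n = 2 * n * Acount E (2 * n) + if Odd n then n * Acount E n else 0 := by
  have hset : {x : Ω | x ≠ 0 ∧ minimalPeriod (fun y : Ω => y ^ Nat.card F) x = n} =
      {x : Ω | x ≠ 0 ∧ minimalPeriod (fun y : Ω => y ^ Nat.card E) x = 2 * n} ∪
        {x : Ω | x ≠ 0 ∧ Odd n ∧ minimalPeriod (fun y : Ω => y ^ Nat.card E) x = n} := by
    ext x
    rw [hF, ← pow_iterate]
    simp only [Set.mem_union, Set.mem_ofPred_eq, minimalPeriod_iterate_two_eq_iff hn]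
    tauto
  have hfin : ∀ m, m ≠ 0 →
      {x : Ω | x ≠ 0 ∧ minimalPeriod (fun y : Ω => y ^ Nat.card E) x = m}.Finite :=
    fun m hm => (finite_setOf_iterate_pow_eq (Finite.one_lt_card (α := E)) hm).subset
      fun x hx => by
        have := iterate_minimalPeriod (f := fun y : Ω => y ^ Nat.card E) (x := x)
        rwa [hx.2] at this
  have hdisj : Disjoint
      {x : Ω | x ≠ 0 ∧ minimalPeriod (fun y : Ω => y ^ Nat.card E) x = 2 * n}
      {x : Ω | x ≠ 0 ∧ Odd n ∧ minimalPeriod (fun y : Ω => y ^ Nat.card E) x = n} :=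
    Set.disjoint_left.2 fun x hx hx' => by
      have := hx.2.symm.trans hx'.2.2
      omega
  rw [mul_Acount_eq_ncard (Ω := Ω) hn, hset, Set.ncard_union_eq hdisj (hfin _ (by omega))
    ((hfin n hn.ne').subset fun x hx => ⟨hx.1, hx.2.2⟩), ← mul_Acount_eq_ncard (by omega)]
  split_ifs with h
  · simp only [h, true_and]
    rw [← mul_Acount_eq_ncard hn]
  · simp [h]

theorem Acount_one_add_one (F : Type*) [Field F] [Finite F] : Acount F 1 + 1 = Nat.card F := by
  let _ := Fintype.ofFinite F
  have hcard : ((Nat.card F : ℕ) : AlgebraicClosure F) = 0 := by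
    rw [← map_natCast (algebraMap F (AlgebraicClosure F)), Nat.card_eq_fintype_card,
      FiniteField.cast_card_eq_zero, map_zero]
  have h := mul_Acount_eq_ncard (k := F) (Ω := AlgebraicClosure F) one_pos
  simp only [minimalPeriod_eq_one_iff_isFixedPt] at h
  have h' := ncard_iterate_pow_eq hcard Nat.card_pos one_ne_zero
  rw [pow_one] at h'
  have hpos : 0 < Nat.card F := Nat.card_pos
  have heq := h.trans h'
  omega

/-- `A⁻(1)(q) = q+1`; `A⁻(n)(q) = A(n)(q)` for odd `n > 1`;
`A⁻(n)(q) = 0` for even `n > 0`; `A⁺(1)(q) = q(q−1)/2 − 1`; and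
`A⁺(n)(q) = A(2n)(q)` for `n > 1`.  Here `E` is the field with `q` elements and `F` the
field with `q²` elements. -/
theorem Aminus_Aplus_relations
    (q : ℕ) (hq : IsPrimePow q)
    (E : Type) [Field E] [Fintype E] (hE : Fintype.card E = q)
    (F : Type) [Field F] [Fintype F] (hF : Fintype.card F = q ^ 2) :
    Aminus q F 1 = q + 1 ∧
    (∀ n : ℕ, 1 < n → Odd n → Aminus q F n = Acount E n) ∧
    (∀ n : ℕ, 0 < n → Even n → Aminus q F n = 0) ∧
    Aplus q F 1 = (q : ℚ) * ((q : ℚ) - 1) / 2 - 1 ∧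
    (∀ n : ℕ, 1 < n → Aplus q F n = Acount E (2 * n)) := by
  have hcE : Nat.card E = q := by rw [Nat.card_eq_fintype_card, hE]
  have hcF : Nat.card F = q ^ 2 := by rw [Nat.card_eq_fintype_card, hF]
  have hq1 : 1 < q := hq.one_lt
  let Ω := AlgebraicClosure F
  have hqF : (q : F) = 0 := by
    have := FiniteField.cast_card_eq_zero F
    rw [hF] at this
    simpa using this
  have hqΩ : (q : Ω) = 0 := by
    rw [← map_natCast (algebraMap F Ω), hqF, map_zero]
  obtain ⟨φ⟩ := exists_ringHom_of_card_eq (E := E) (F := F) (Ω := Ω) (by rw [hF, hE])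
  let _ : Algebra E Ω := φ.toAlgebra
  have hA : ∀ n, 0 < n →
      n * Acount F n = 2 * n * Acount E (2 * n) + if Odd n then n * Acount E n else 0 :=
    fun n hn => mul_Acount_sq_eq (Ω := Ω) (by rw [hcF, hcE]) hn
  have hAminus : ∀ n, 0 < n → n * Aminus q F n =
      if Odd n then n * Acount E n + (if n = 1 then 2 else 0) else 0 := by
    intro n hn
    rw [mul_Aminus_eq (Ω := Ω) hcF hn]
    split_ifs with h h1
    · rw [ncard_minimalPeriod_inv_pow hqΩ hq1 h, if_pos h1, mul_Acount_eq_ncard (Ω := Ω) hn, hcE]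
    · rw [ncard_minimalPeriod_inv_pow hqΩ hq1 h, if_neg h1, mul_Acount_eq_ncard (Ω := Ω) hn, hcE]
    · rfl
  have hE1 : Acount E 1 + 1 = q := hcE ▸ Acount_one_add_one E
  have hF1 : Acount F 1 + 1 = q ^ 2 := hcF ▸ Acount_one_add_one F
  have hone : Aminus q F 1 = q + 1 := by
    have := hAminus 1 one_pos
    rw [if_pos odd_one, if_pos rfl] at this
    omega
  have hodd : ∀ n : ℕ, 1 < n → Odd n → Aminus q F n = Acount E n := by
    intro n hn hodd
    have := hAminus n (by omega)
    rw [if_pos hodd, if_neg hn.ne', add_zero] at this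
    exact Nat.eq_of_mul_eq_mul_left (by omega) this
  have heven : ∀ n : ℕ, 0 < n → Even n → Aminus q F n = 0 := by
    intro n hn heven
    have := hAminus n hn
    rw [if_neg (Nat.not_odd_iff_even.2 heven)] at this
    exact (Nat.mul_eq_zero.1 this).resolve_left hn.ne'
  refine ⟨hone, hodd, heven, ?_, fun n hn => ?_⟩
  · have hF1' : (Acount F 1 : ℚ) + 1 = (q : ℚ) ^ 2 := by exact_mod_cast hF1
    rw [Aplus, hone, eq_sub_of_add_eq hF1']
    push_cast
    ring
  · have h : Acount F n = 2 * Acount E (2 * n) + Aminus q F n := by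
      refine Nat.eq_of_mul_eq_mul_left (by omega : 0 < n) ?_
      rw [hA n (by omega), mul_add]
      rcases Nat.even_or_odd n with hn' | hn'
      · rw [if_neg (Nat.not_odd_iff_even.2 hn'), heven n (by omega) hn']
        ring
      · rw [if_pos hn', hodd n hn hn']
        ring
    rw [Aplus, h]
    push_cast
    ring
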